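/- arXiv:1508.01917 — 3 statements merged into one kernel-verified Lean document; each statement's English description precedes it below -/
import Mathlib

section
/- Let (P, ⪯) be a compact metrizable topological space equipped with a partial order such that the strict relation ≺ = {(x,y) : x ⪯ y and x ≠ y} is closed in P × P. Let A be a unital C*-algebra and for each x ∈ P let Iₓ be an isocone of A, such that the set-valued map x ↦ Iₓ is lower hemi-continuous: for every open set V ⊆ A, the set {x ∈ P : Iₓ ∩ V ≠ ∅} is open in P. Let 𝒜 = C(P, A) be the C*-algebra of continuous functions from P to A with the sup norm. Then the set L = { f ∈ C(P,A) : f(x) ∈ Iₓ for all x ∈ P, and for all x, y ∈ P with x ≺ y one has max σ(f(x)) ≤ min σ(f(y)) } is an isocone of 𝒜, where σ(b) denotes the spectrum of the self-adjoint element b (a nonempty compact subset of ℝ). -/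
open scoped ComplexOrder

def IsState {A : Type*} [CStarAlgebra A] (φ : A →ₗ[ℂ] ℂ) : Prop :=
  φ 1 = 1 ∧ ∀ a : A, 0 ≤ φ (star a * a)

def IsIsocone {A : Type*} [CStarAlgebra A] (I : Set A) : Prop :=
  I.Nonempty ∧
  (∀ a ∈ I, IsSelfAdjoint a) ∧
  (∀ a ∈ I, ∀ f : ℝ → ℝ, Continuous f → Monotone f → cfc f a ∈ I) ∧
  (∀ a ∈ I, ∀ b ∈ I, a + b ∈ I) ∧
  IsClosed I ∧
  (∀ φ ψ : A →ₗ[ℂ] ℂ, IsState φ → IsState ψ → (∀ a ∈ I, φ a = ψ a) → φ = ψ)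

section Selection

open Filter Topology Set

/-- **Michael selection theorem** over compact Hausdorff spaces. -/
theorem exists_continuous_selection {X E : Type*} [TopologicalSpace X] [CompactSpace X] [T2Space X]
    [NormedAddCommGroup E] [NormedSpace ℝ E] [CompleteSpace E] {F : X → Set E}
    (hne : ∀ x, (F x).Nonempty) (hconv : ∀ x, Convex ℝ (F x)) (hcl : ∀ x, IsClosed (F x))
    (hlhc : ∀ V : Set E, IsOpen V → IsOpen {x | (F x ∩ V).Nonempty}) :
    ∃ f : C(X, E), ∀ x, f x ∈ F x := by
  have approx (ε : ℝ) (hε : 0 < ε) :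
      ∃ g : C(X, E), ∀ x, g x ∈ Metric.thickening ε (F x) := by
    refine exists_continuous_forall_mem_convex_of_local_const
      (fun x => (hconv x).thickening ε) fun x => ?_
    obtain ⟨b, hb⟩ := hne x
    refine ⟨b, ?_⟩
    filter_upwards [(hlhc _ Metric.isOpen_ball).mem_nhds ⟨b, hb, Metric.mem_ball_self hε⟩]
      with y ⟨c, hc, hcb⟩
    exact Metric.mem_thickening_iff.2 ⟨c, hc, Metric.mem_ball'.1 hcb⟩
  have refine_approx (ε : ℝ) (g : C(X, E)) (hg : ∀ x, g x ∈ Metric.thickening ε (F x))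
      (δ : ℝ) (hδ : 0 < δ) :
      ∃ g' : C(X, E), ∀ x, g' x ∈ Metric.ball (g x) ε ∩ Metric.thickening δ (F x) := by
    refine exists_continuous_forall_mem_convex_of_local_const
      (fun x => (convex_ball _ _).inter ((hconv x).thickening δ)) fun x => ?_
    obtain ⟨b, hb, hgb⟩ := Metric.mem_thickening_iff.1 (hg x)
    refine ⟨b, ?_⟩
    have hcont : ∀ᶠ y in 𝓝 x, dist (g y) b < ε :=
      (g.continuous.dist continuous_const).continuousAt.eventually_lt_const hgb
    filter_upwards [(hlhc _ Metric.isOpen_ball).mem_nhds ⟨b, hb, Metric.mem_ball_self hδ⟩, hcont]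
      with y ⟨c, hc, hcb⟩ hy
    exact ⟨Metric.mem_ball'.2 hy, Metric.mem_thickening_iff.2 ⟨c, hc, Metric.mem_ball'.1 hcb⟩⟩
  have hpos (n : ℕ) : (0 : ℝ) < 1 / 2 / 2 ^ n := by positivity
  choose! next hnext using refine_approx
  obtain ⟨g₀, hg₀⟩ := approx (1 / 2 / 2 ^ 0) (hpos 0)
  let g : ℕ → C(X, E) :=
    fun n => Nat.rec g₀ (fun n h => next (1 / 2 / 2 ^ n) h (1 / 2 / 2 ^ (n + 1))) n
  have hg : ∀ n x, g n x ∈ Metric.thickening (1 / 2 / 2 ^ n) (F x) := by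
    intro n
    induction n with
    | zero => exact hg₀
    | succ n ih => exact fun x => (hnext _ _ ih _ (hpos (n + 1)) x).2
  have hdist (n : ℕ) : dist (g n) (g (n + 1)) ≤ 1 / 2 / 2 ^ n :=
    (ContinuousMap.dist_le (hpos n).le).2 fun x =>
      (Metric.mem_ball'.1 (hnext _ _ (hg n) _ (hpos (n + 1)) x).1).le
  obtain ⟨f, hf⟩ := cauchySeq_tendsto_of_complete (cauchySeq_of_le_geometric_two hdist)
  refine ⟨f, fun x => ?_⟩
  have hfx : Tendsto (fun n => g n x) atTop (𝓝 (f x)) :=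
    ((continuous_eval_const x).tendsto f).comp hf
  have hinf : Tendsto (fun n => Metric.infDist (g n x) (F x)) atTop
      (𝓝 (Metric.infDist (f x) (F x))) :=
    ((Metric.continuous_infDist_pt (F x)).tendsto _).comp hfx
  have hzero : Tendsto (fun n => Metric.infDist (g n x) (F x)) atTop (𝓝 0) := by
    refine squeeze_zero (g := fun n : ℕ => (1 / 2 : ℝ) / 2 ^ n)
      (fun _ => Metric.infDist_nonneg) (fun n => ?_) ?_
    · obtain ⟨c, hc, hd⟩ := Metric.mem_thickening_iff.1 (hg n x)
      exact (Metric.infDist_le_dist_of_mem hc).trans hd.le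
    · exact tendsto_const_nhds.div_atTop (tendsto_pow_atTop_atTop_of_one_lt one_lt_two)
  exact ((hcl x).mem_iff_infDist_zero (hne x)).2 (tendsto_nhds_unique hinf hzero)

/-- A lower hemicontinuous map with closed convex values admits a continuous selection through any
prescribed point of its graph. -/
theorem exists_continuous_selection_apply_eq {X E : Type*} [TopologicalSpace X] [CompactSpace X]
    [T2Space X] [NormedAddCommGroup E] [NormedSpace ℝ E] [CompleteSpace E] {F : X → Set E}
    (hne : ∀ x, (F x).Nonempty) (hconv : ∀ x, Convex ℝ (F x)) (hcl : ∀ x, IsClosed (F x))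
    (hlhc : ∀ V : Set E, IsOpen V → IsOpen {x | (F x ∩ V).Nonempty})
    {x₀ : X} {a : E} (ha : a ∈ F x₀) :
    ∃ f : C(X, E), (∀ x, f x ∈ F x) ∧ f x₀ = a := by
  classical
  obtain ⟨f, hf⟩ := exists_continuous_selection (F := Function.update F x₀ {a})
    (fun x => by by_cases h : x = x₀ <;> [(subst h; simp); simpa [h] using hne x])
    (fun x => by by_cases h : x = x₀ <;> [(subst h; simp); simpa [h] using hconv x])
    (fun x => by by_cases h : x = x₀ <;> [(subst h; simp); simpa [h] using hcl x])
    (fun V hV => by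
      by_cases haV : a ∈ V
      · convert hlhc V hV using 3 with x
        by_cases h : x = x₀
        · subst h
          simpa [haV] using ⟨a, ha, haV⟩
        · simp [h]
      · convert (hlhc V hV).inter (isOpen_compl_singleton (x := x₀)) using 1
        ext x
        by_cases h : x = x₀
        · subst h
          simp [haV]
        · simp [h])
  have hx₀ : f x₀ = a := by simpa using hf x₀
  refine ⟨f, fun x => ?_, hx₀⟩
  by_cases h : x = x₀
  · rw [h, hx₀]
    exact ha
  · simpa [h] using hf x

/-- Sequences whose consecutive terms nearly satisfy a closed strict order on a compact space have
uniformly bounded length. -/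
theorem exists_near_lt_chain_bound {P : Type*} [MetricSpace P] [CompactSpace P]
    [PartialOrder P] (hstrict : IsClosed {p : P × P | p.1 < p.2})
    (hne : {p : P × P | p.1 < p.2}.Nonempty) :
    ∃ k : ℕ, ∀ p : ℕ → P, ∃ i < k,
      1 / ((k : ℝ) + 1) ≤ Metric.infDist (p i, p (i + 1)) {p : P × P | p.1 < p.2} := by
  by_contra! h
  choose p hp using h
  obtain ⟨q, φ, hφ, hq⟩ := CompactSpace.tendsto_subseq p
  have hchain (i : ℕ) : q i < q (i + 1) := by
    have hlim : Tendsto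
        (fun n => Metric.infDist (p (φ n) i, p (φ n) (i + 1)) {p : P × P | p.1 < p.2}) atTop
        (𝓝 (Metric.infDist (q i, q (i + 1)) {p : P × P | p.1 < p.2})) :=
      ((Metric.continuous_infDist_pt _).tendsto _).comp
        (((tendsto_pi_nhds.1 hq i)).prodMk_nhds (tendsto_pi_nhds.1 hq (i + 1)))
    have hzero : Tendsto
        (fun n => Metric.infDist (p (φ n) i, p (φ n) (i + 1)) {p : P × P | p.1 < p.2}) atTop
        (𝓝 0) := by
      refine squeeze_zero' (Eventually.of_forall fun _ => Metric.infDist_nonneg) ?_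
        (tendsto_one_div_add_atTop_nhds_zero_nat.comp hφ.tendsto_atTop)
      filter_upwards [hφ.tendsto_atTop.eventually_gt_atTop i] with n hn
      exact (hp (φ n) i hn).le
    exact (hstrict.mem_iff_infDist_zero hne).2 (tendsto_nhds_unique hlim hzero)
  obtain ⟨z, ψ, hψ, hz⟩ := CompactSpace.tendsto_subseq q
  have hmono : StrictMono q := strictMono_nat_of_lt_succ hchain
  have hzz : ((z, z) : P × P) ∈ {p : P × P | p.1 < p.2} :=
    hstrict.mem_of_tendsto (hz.prodMk_nhds (hz.comp (tendsto_add_atTop_nat 1)))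
      (Eventually.of_forall fun n => hmono (hψ n.lt_succ_self))
  exact lt_irrefl z hzz

/-- A compact metrizable poset with closed strict order carries a continuous real function which
increases by at least one along every strict inequality. -/
theorem exists_continuous_add_one_le_of_lt {P : Type*} [TopologicalSpace P] [CompactSpace P]
    [TopologicalSpace.MetrizableSpace P] [PartialOrder P]
    (hstrict : IsClosed {p : P × P | p.1 < p.2}) :
    ∃ u : C(P, ℝ), ∀ x y : P, x < y → u x + 1 ≤ u y := by
  let _ := TopologicalSpace.metrizableSpaceMetric P
  rcases {p : P × P | p.1 < p.2}.eq_empty_or_nonempty with hempty | hne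
  · exact ⟨0, fun x y hxy => (eq_empty_iff_forall_notMem.1 hempty (x, y) hxy).elim⟩
  have : Nonempty P := ⟨hne.some.1⟩
  obtain ⟨k, hk⟩ := exists_near_lt_chain_bound hstrict hne
  let w : P × P → ℝ := fun p =>
    max 0 (1 - ((k : ℝ) + 1) * Metric.infDist p {p : P × P | p.1 < p.2})
  have hwc : Continuous w :=
    continuous_const.max (continuous_const.sub
      (continuous_const.mul (Metric.continuous_infDist_pt _)))
  have hw_one {x y : P} (hxy : x < y) : w (x, y) = 1 := by
    have h0 : Metric.infDist (x, y) {p : P × P | p.1 < p.2} = 0 :=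
      Metric.infDist_zero_of_mem hxy
    simp [w, h0]
  have hw_zero {x y : P}
      (hxy : 1 / ((k : ℝ) + 1) ≤ Metric.infDist (x, y) {p : P × P | p.1 < p.2}) :
      w (x, y) = 0 := by
    refine max_eq_left ?_
    rw [div_le_iff₀' (by positivity)] at hxy
    linarith
  have hsup (v : C(P, ℝ)) : Continuous fun y => ⨆ x, w (x, y) * (1 + v x) := by
    have := isCompact_univ.continuous_sSup (f := fun y x => w (x, y) * (1 + v x)) (K := univ)
      (by fun_prop)
    simpa [image_univ, sSup_range] using this
  let u : ℕ → C(P, ℝ) := fun n => Nat.rec 0 (fun _ v => ⟨_, hsup v⟩) n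
  have hu_succ (n : ℕ) (y : P) : u (n + 1) y = ⨆ x, w (x, y) * (1 + u n x) := rfl
  have hstep (n : ℕ) (y : P) (h : u (n + 1 + 1) y ≠ u (n + 1) y) :
      ∃ x, w (x, y) ≠ 0 ∧ u (n + 1) x ≠ u n x := by
    by_contra! hall
    refine h (iSup_congr fun x => ?_)
    by_cases hx : w (x, y) = 0
    · rw [hx, zero_mul, zero_mul]
    · change w (x, y) * (1 + u (n + 1) x) = w (x, y) * (1 + u n x)
      rw [hall x hx]
  have hpath (n : ℕ) : ∀ y, u (n + 1) y ≠ u n y →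
      ∃ p : ℕ → P, p n = y ∧ ∀ i < n, w (p i, p (i + 1)) ≠ 0 := by
    induction n with
    | zero => exact fun y _ => ⟨fun _ => y, rfl, fun i hi => absurd hi i.not_lt_zero⟩
    | succ n ih =>
      intro y hy
      obtain ⟨x, hxy, hx⟩ := hstep n y hy
      obtain ⟨p, hpn, hp⟩ := ih x hx
      refine ⟨fun i => if i ≤ n then p i else y, by simp, fun i hi => ?_⟩
      rcases (Nat.lt_succ_iff.1 hi).lt_or_eq with hlt | rfl
      · simpa [hlt.le, Nat.succ_le_of_lt hlt] using hp i hlt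
      · simpa [hpn] using hxy
  have hfix (y : P) : u (k + 1) y = u k y := by
    by_contra h
    obtain ⟨p, -, hp⟩ := hpath k y h
    obtain ⟨i, hi, hfar⟩ := hk p
    exact hp i hi (hw_zero hfar)
  refine ⟨u k, fun x y hxy => ?_⟩
  have hbdd : BddAbove (range fun x => w (x, y) * (1 + u k x)) :=
    (isCompact_range (by fun_prop)).bddAbove
  calc u k x + 1 = w (x, y) * (1 + u k x) := by rw [hw_one hxy]; ring
    _ ≤ ⨆ x, w (x, y) * (1 + u k x) := le_ciSup hbdd x
    _ = u k y := by rw [← hu_succ, hfix]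

end Selection

section Order

variable {A : Type*} [CStarAlgebra A] [PartialOrder A] [StarOrderedRing A]

theorem csSup_spectrum_le_csInf_spectrum_iff {a b : A} (ha : IsSelfAdjoint a)
    (hb : IsSelfAdjoint b) :
    sSup (spectrum ℝ a) ≤ sInf (spectrum ℝ b) ↔
      ∃ r : ℝ, a ≤ algebraMap ℝ A r ∧ algebraMap ℝ A r ≤ b := by
  rcases subsingleton_or_nontrivial A with hA | hA
  · simp [spectrum.of_subsingleton, Subsingleton.elim a b, Subsingleton.elim (algebraMap ℝ A _) b]
  have hane : (spectrum ℝ a).Nonempty := ContinuousFunctionalCalculus.spectrum_nonempty a ha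
  have hbne : (spectrum ℝ b).Nonempty := ContinuousFunctionalCalculus.spectrum_nonempty b hb
  have hac : IsCompact (spectrum ℝ a) := ContinuousFunctionalCalculus.isCompact_spectrum a
  have hbc : IsCompact (spectrum ℝ b) := ContinuousFunctionalCalculus.isCompact_spectrum b
  constructor
  · intro h
    refine ⟨sSup (spectrum ℝ a), ?_, ?_⟩
    · exact (le_algebraMap_iff_spectrum_le ha).2 fun x hx => le_csSup hac.bddAbove hx
    · exact (algebraMap_le_iff_le_spectrum hb).2 fun x hx => h.trans (csInf_le hbc.bddBelow hx)
  · rintro ⟨r, har, hrb⟩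
    exact (csSup_le hane ((le_algebraMap_iff_spectrum_le ha).1 har)).trans
      (le_csInf hbne ((algebraMap_le_iff_le_spectrum hb).1 hrb))

theorem csSup_spectrum_le_csInf_spectrum_add {a b a' b' : A} (ha : IsSelfAdjoint a)
    (hb : IsSelfAdjoint b) (ha' : IsSelfAdjoint a') (hb' : IsSelfAdjoint b')
    (h : sSup (spectrum ℝ a) ≤ sInf (spectrum ℝ b))
    (h' : sSup (spectrum ℝ a') ≤ sInf (spectrum ℝ b')) :
    sSup (spectrum ℝ (a + a')) ≤ sInf (spectrum ℝ (b + b')) := by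
  obtain ⟨r, har, hrb⟩ := (csSup_spectrum_le_csInf_spectrum_iff ha hb).1 h
  obtain ⟨s, has, hsb⟩ := (csSup_spectrum_le_csInf_spectrum_iff ha' hb').1 h'
  refine (csSup_spectrum_le_csInf_spectrum_iff (ha.add ha') (hb.add hb')).2 ⟨r + s, ?_, ?_⟩
  · rw [map_add]
    exact add_le_add har has
  · rw [map_add]
    exact add_le_add hrb hsb

theorem csSup_spectrum_le_csInf_spectrum_cfc {a b : A} (ha : IsSelfAdjoint a)
    (hb : IsSelfAdjoint b) {g : ℝ → ℝ} (hg : Continuous g) (hmono : Monotone g)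
    (h : sSup (spectrum ℝ a) ≤ sInf (spectrum ℝ b)) :
    sSup (spectrum ℝ (cfc g a)) ≤ sInf (spectrum ℝ (cfc g b)) := by
  obtain ⟨r, har, hrb⟩ := (csSup_spectrum_le_csInf_spectrum_iff ha hb).1 h
  refine (csSup_spectrum_le_csInf_spectrum_iff (cfc_predicate g a) (cfc_predicate g b)).2
    ⟨g r, ?_, ?_⟩
  · exact cfc_le_algebraMap g (g r) a
      (fun x hx => hmono ((le_algebraMap_iff_spectrum_le ha).1 har x hx)) hg.continuousOn ha
  · exact algebraMap_le_cfc g (g r) b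
      (fun x hx => hmono ((algebraMap_le_iff_le_spectrum hb).1 hrb x hx)) hg.continuousOn hb

theorem IsSelfAdjoint.le_algebraMap_of_norm_le {a : A} (ha : IsSelfAdjoint a) {r : ℝ}
    (h : ‖a‖ ≤ r) : a ≤ algebraMap ℝ A r :=
  ha.le_algebraMap_norm_self.trans (algebraMap_mono A h)

theorem IsSelfAdjoint.algebraMap_neg_le_of_norm_le {a : A} (ha : IsSelfAdjoint a) {r : ℝ}
    (h : ‖a‖ ≤ r) : algebraMap ℝ A (-r) ≤ a := by
  have := ha.neg.le_algebraMap_of_norm_le ((norm_neg a).trans_le h)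
  rwa [map_neg, neg_le]

theorem csSup_spectrum_le_csInf_spectrum_of_forall_norm_sub_le {a b : A} (ha : IsSelfAdjoint a)
    (hb : IsSelfAdjoint b)
    (h : ∀ ε > 0, ∃ a' b' : A, IsSelfAdjoint a' ∧ IsSelfAdjoint b' ∧ ‖a - a'‖ ≤ ε ∧ ‖b - b'‖ ≤ ε ∧
      sSup (spectrum ℝ a') ≤ sInf (spectrum ℝ b')) :
    sSup (spectrum ℝ a) ≤ sInf (spectrum ℝ b) := by
  rcases subsingleton_or_nontrivial A with hA | hA
  · simp [spectrum.of_subsingleton]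
  refine le_of_forall_pos_le_add fun ε hε => ?_
  obtain ⟨a', b', ha', hb', haa', hbb', hab⟩ := h (ε / 2) (half_pos hε)
  obtain ⟨r, har, hrb⟩ := (csSup_spectrum_le_csInf_spectrum_iff ha' hb').1 hab
  have hupper : a ≤ algebraMap ℝ A (r + ε / 2) := by
    rw [map_add]
    calc a = a' + (a - a') := by abel
      _ ≤ _ := add_le_add har ((ha.sub ha').le_algebraMap_of_norm_le haa')
  have hlower : algebraMap ℝ A (r + -(ε / 2)) ≤ b := by
    rw [map_add]
    calc _ ≤ b' + (b - b') :=
          add_le_add hrb ((hb.sub hb').algebraMap_neg_le_of_norm_le hbb')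
      _ = b := by abel
  have h₁ := csSup_le (ContinuousFunctionalCalculus.spectrum_nonempty a ha)
    ((le_algebraMap_iff_spectrum_le ha).1 hupper)
  have h₂ := le_csInf (ContinuousFunctionalCalculus.spectrum_nonempty b hb)
    ((algebraMap_le_iff_le_spectrum hb).1 hlower)
  linarith

/-- Every bounded real functional on the self-adjoint part is a difference of positive ones. -/
theorem exists_nonneg_sub_eq [Nontrivial A] (f : selfAdjoint A →L[ℝ] ℝ) :
    ∃ φ ψ : selfAdjoint A →ₗ[ℝ] ℝ, (∀ a : selfAdjoint A, 0 ≤ (a : A) → 0 ≤ φ a) ∧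
      (∀ a : selfAdjoint A, 0 ≤ (a : A) → 0 ≤ ψ a) ∧ ∀ a, f a = φ a - ψ a := by
  let cone : PointedCone ℝ (selfAdjoint A × selfAdjoint A × ℝ) :=
    { carrier := {v | 0 ≤ (v.1 : A) + algebraMap ℝ A v.2.2 ∧
        0 ≤ (v.2.1 : A) + algebraMap ℝ A v.2.2}
      add_mem' := by
        rintro v w ⟨hv₁, hv₂⟩ ⟨hw₁, hw₂⟩
        constructor
        · convert add_nonneg hv₁ hw₁ using 1
          simp only [Prod.fst_add, Prod.snd_add, AddSubgroup.coe_add, map_add]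
          abel
        · convert add_nonneg hv₂ hw₂ using 1
          simp only [Prod.fst_add, Prod.snd_add, AddSubgroup.coe_add, map_add]
          abel
      zero_mem' := by simp
      smul_mem' := by
        rintro ⟨c, hc⟩ v ⟨hv₁, hv₂⟩
        constructor
        · convert smul_nonneg hc hv₁ using 1
          simp [Algebra.algebraMap_eq_smul_one, smul_smul]
        · convert smul_nonneg hc hv₂ using 1
          simp [Algebra.algebraMap_eq_smul_one, smul_smul] }
  let p : (selfAdjoint A × selfAdjoint A × ℝ) →ₗ.[ℝ] ℝ :=
    { domain := LinearMap.ker (LinearMap.fst ℝ (selfAdjoint A) (selfAdjoint A × ℝ) +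
        LinearMap.fst ℝ (selfAdjoint A) ℝ ∘ₗ LinearMap.snd ℝ (selfAdjoint A) (selfAdjoint A × ℝ))
      toFun := ((f : selfAdjoint A →ₗ[ℝ] ℝ) ∘ₗ LinearMap.fst ℝ (selfAdjoint A) (selfAdjoint A × ℝ) +
        ‖f‖ • (LinearMap.snd ℝ (selfAdjoint A) ℝ ∘ₗ
          LinearMap.snd ℝ (selfAdjoint A) (selfAdjoint A × ℝ))) ∘ₗ Submodule.subtype _ }
  obtain ⟨g, hgp, hg⟩ := riesz_extension cone p
    (by
      rintro ⟨⟨a, b, c⟩, hab⟩ ⟨h₁, h₂⟩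
      have hab' : b = -a := by
        have : a + b = 0 := hab
        exact (neg_eq_of_add_eq_zero_right this).symm
      subst hab'
      change 0 ≤ f a + ‖f‖ * c
      have hac : ‖(a : A)‖ ≤ c := by
        have hub : (a : A) ≤ algebraMap ℝ A c := by
          simpa [add_comm, ← sub_eq_add_neg] using h₂
        have hlb : algebraMap ℝ A (-c) ≤ (a : A) := by
          simpa [neg_le_iff_add_nonneg] using h₁
        rcases CStarAlgebra.norm_or_neg_norm_mem_spectrum a.2 with hmem | hmem
        · exact (le_algebraMap_iff_spectrum_le a.2).1 hub _ hmem
        · exact neg_le_neg_iff.1 ((algebraMap_le_iff_le_spectrum a.2).1 hlb _ hmem)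
      have := (neg_abs_le (f a)).trans' (neg_le_neg (f.le_opNorm a))
      have h3 : ‖f‖ * ‖a‖ ≤ ‖f‖ * c := mul_le_mul_of_nonneg_left hac (norm_nonneg f)
      linarith)
    (by
      rintro ⟨a, b, c⟩
      refine ⟨⟨(0, 0, max ‖a‖ ‖b‖ - c), by simp [p]⟩, ?_, ?_⟩
      · have := a.2.algebraMap_neg_le_of_norm_le (le_max_left ‖a‖ ‖b‖)
        rw [map_neg, neg_le_iff_add_nonneg] at this
        simpa using this
      · have := b.2.algebraMap_neg_le_of_norm_le (le_max_right ‖a‖ ‖b‖)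
        rw [map_neg, neg_le_iff_add_nonneg] at this
        simpa using this)
  refine ⟨g ∘ₗ LinearMap.inl ℝ (selfAdjoint A) (selfAdjoint A × ℝ),
    g ∘ₗ LinearMap.inr ℝ (selfAdjoint A) (selfAdjoint A × ℝ) ∘ₗ LinearMap.inl ℝ (selfAdjoint A) ℝ,
    fun a ha => ?_, fun a ha => ?_, fun a => ?_⟩
  · exact hg (a, 0, 0) ⟨by simpa using ha, by simp⟩
  · exact hg (0, a, 0) ⟨by simp, by simpa using ha⟩
  · have := hgp ⟨(a, -a, 0), by simp [p]⟩
    have h2 : p ⟨(a, -a, 0), by simp [p]⟩ = f a := by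
      change f a + ‖f‖ * 0 = f a
      simp
    rw [← h2, ← this]
    change g (a, -a, 0) = g (a, 0, 0) - g (0, a, 0)
    rw [← map_sub]
    simp

end Order

theorem IsState.norm_apply_le {B : Type*} [CStarAlgebra B] {φ : B →ₗ[ℂ] ℂ} (hφ : IsState φ)
    {a : B} (ha : IsSelfAdjoint a) : ‖φ a‖ ≤ ‖a‖ := by
  let _ := CStarAlgebra.spectralOrder B
  have _ := CStarAlgebra.spectralOrderedRing B
  have hpos {b : B} (hb : 0 ≤ b) : 0 ≤ φ b := by
    obtain ⟨c, rfl⟩ := CStarAlgebra.nonneg_iff_eq_star_mul_self.1 hb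
    exact hφ.2 c
  have hscalar (r : ℝ) : φ (algebraMap ℝ B r) = (r : ℂ) := by
    rw [IsScalarTower.algebraMap_apply ℝ ℂ B, Algebra.algebraMap_eq_smul_one, map_smul, hφ.1]
    simp
  have hupper := hpos (sub_nonneg.2 (ha.le_algebraMap_of_norm_le le_rfl))
  have hlower := hpos (sub_nonneg.2 (ha.algebraMap_neg_le_of_norm_le le_rfl))
  rw [map_sub, hscalar, Complex.le_def] at hupper hlower
  have him : (φ a).im = 0 := by simpa using hlower.2.symm
  have hre : φ a = ((φ a).re : ℂ) := Complex.ext rfl (by simpa using him)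
  rw [hre, Complex.norm_real, Real.norm_eq_abs, abs_le]
  constructor
  · simpa [neg_le_iff_add_nonneg] using hlower.1
  · simpa using hupper.1

/-- The complex linear extension of a positive real functional of positive mass on the
self-adjoint part is, after normalization, a state. -/
theorem exists_isState_eq_div {A : Type*} [CStarAlgebra A] [PartialOrder A] [StarOrderedRing A]
    (φ : selfAdjoint A →ₗ[ℝ] ℝ) (hφ : ∀ a : selfAdjoint A, 0 ≤ (a : A) → 0 ≤ φ a)
    (hone : 0 < φ 1) :
    ∃ Φ : A →ₗ[ℂ] ℂ, IsState Φ ∧ ∀ a : selfAdjoint A, Φ a = ((φ a / φ 1 : ℝ) : ℂ) := by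
  let Φ : A →ₗ[ℂ] ℂ :=
    Module.Dual.extendRCLike (𝕜 := ℂ) (((φ 1)⁻¹ • φ) ∘ₗ (realPart : A →ₗ[ℝ] selfAdjoint A))
  have hΦ (a : selfAdjoint A) : Φ a = ((φ a / φ 1 : ℝ) : ℂ) := by
    have hre : realPart (a : A) = a := Subtype.ext a.2.coe_realPart
    have him : imaginaryPart (a : A) = 0 := a.2.imaginaryPart
    rw [Module.Dual.extendRCLike_apply]
    simp [hre, him, div_eq_inv_mul]
  refine ⟨Φ, ⟨?_, fun a => ?_⟩, hΦ⟩
  · rw [← selfAdjoint.val_one, hΦ, div_self hone.ne', Complex.ofReal_one]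
  · have := hΦ ⟨star a * a, IsSelfAdjoint.star_mul_self a⟩
    rw [this, Complex.zero_le_real]
    exact div_nonneg (hφ _ (star_mul_self_nonneg a)) hone.le

section Isocone

variable {A : Type*} [CStarAlgebra A] {I : Set A}

theorem IsIsocone.algebraMap_mem (hI : IsIsocone I) (r : ℝ) : algebraMap ℝ A r ∈ I := by
  obtain ⟨a, ha⟩ := hI.1
  have := hI.2.2.1 a ha (fun _ => r) continuous_const monotone_const
  rwa [cfc_const r a (hI.2.1 a ha)] at this

theorem IsIsocone.smul_mem (hI : IsIsocone I) {r : ℝ} (hr : 0 ≤ r) {a : A} (ha : a ∈ I) :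
    r • a ∈ I := by
  have := hI.2.2.1 a ha (fun x => r • x) (by fun_prop)
    (fun x y hxy => mul_le_mul_of_nonneg_left hxy hr)
  rwa [cfc_smul_id r a (hI.2.1 a ha)] at this

theorem IsIsocone.convex (hI : IsIsocone I) : Convex ℝ I := fun _ ha _ hb _ _ hr hs _ =>
  hI.2.2.2.1 _ (hI.smul_mem hr ha) _ (hI.smul_mem hs hb)

/-- Differences of elements of an isocone are dense in the self-adjoint part. -/
theorem IsIsocone.exists_norm_sub_sub_lt (hI : IsIsocone I) {h : A} (hh : IsSelfAdjoint h)
    {ε : ℝ} (hε : 0 < ε) : ∃ a ∈ I, ∃ b ∈ I, ‖h - (a - b)‖ < ε := by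
  let _ := CStarAlgebra.spectralOrder A
  have _ := CStarAlgebra.spectralOrderedRing A
  have hzero : (0 : A) ∈ I := by simpa using hI.algebraMap_mem 0
  rcases subsingleton_or_nontrivial A with hA | hA
  · exact ⟨0, hzero, 0, hzero, by simpa [Subsingleton.elim h 0] using hε⟩
  let V : Submodule ℝ (selfAdjoint A) :=
    { carrier := {c | ∃ a ∈ I, ∃ b ∈ I, (c : A) = a - b}
      zero_mem' := ⟨0, hzero, 0, hzero, by simp⟩
      add_mem' := by
        rintro c d ⟨a, ha, b, hb, hc⟩ ⟨a', ha', b', hb', hd⟩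
        refine ⟨a + a', hI.2.2.2.1 _ ha _ ha', b + b', hI.2.2.2.1 _ hb _ hb', ?_⟩
        rw [AddSubgroup.coe_add, hc, hd]
        abel
      smul_mem' := by
        rintro r c ⟨a, ha, b, hb, hc⟩
        rcases le_total 0 r with hr | hr
        · refine ⟨r • a, hI.smul_mem hr ha, r • b, hI.smul_mem hr hb, ?_⟩
          rw [selfAdjoint.val_smul, hc, smul_sub]
        · refine ⟨(-r) • b, hI.smul_mem (neg_nonneg.2 hr) hb, (-r) • a,
            hI.smul_mem (neg_nonneg.2 hr) ha, ?_⟩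
          rw [selfAdjoint.val_smul, hc, smul_sub, neg_smul, neg_smul]
          abel }
  have hIV {a : A} (ha : a ∈ I) : (⟨a, hI.2.1 a ha⟩ : selfAdjoint A) ∈ V :=
    ⟨a, ha, 0, hzero, by simp⟩
  by_contra! hfar
  have hnot : (⟨h, hh⟩ : selfAdjoint A) ∉ closure (V : Set (selfAdjoint A)) := by
    intro hmem
    obtain ⟨c, ⟨a, ha, b, hb, hc⟩, hdist⟩ := Metric.mem_closure_iff.1 hmem ε hε
    refine (hfar a ha b hb).not_gt ?_
    rw [← hc, ← dist_eq_norm]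
    exact hdist
  obtain ⟨f, u, hfV, hfh⟩ :=
    geometric_hahn_banach_closed_point V.convex.closure isClosed_closure hnot
  have hu : 0 < u := by simpa using hfV 0 (subset_closure V.zero_mem)
  have hf_zero : ∀ v ∈ V, f v = 0 := by
    intro v hv
    by_contra hne
    have := hfV ((u / f v) • v) (subset_closure (V.smul_mem _ hv))
    rw [map_smul, smul_eq_mul, div_mul_cancel₀ _ hne] at this
    exact lt_irrefl u this
  have hfh' : f ⟨h, hh⟩ ≠ 0 := (hu.trans hfh).ne'
  obtain ⟨φ, ψ, hφ, hψ, hfφψ⟩ := exists_nonneg_sub_eq f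
  have hone : φ 1 = ψ 1 := by
    have hmem : (1 : selfAdjoint A) ∈ V :=
      ⟨1, by simpa using hI.algebraMap_mem 1, 0, hzero, by simp⟩
    exact sub_eq_zero.1 ((hfφψ 1).symm.trans (hf_zero 1 hmem))
  have hone_nonneg : 0 ≤ φ 1 := hφ 1 (by simp)
  have hbound (χ : selfAdjoint A →ₗ[ℝ] ℝ) (hχ : ∀ a : selfAdjoint A, 0 ≤ (a : A) → 0 ≤ χ a)
      (hχ1 : χ 1 = 0) (a : selfAdjoint A) : χ a = 0 := by
    have h₁ := hχ (‖a‖ • 1 - a) (by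
      simpa [Algebra.algebraMap_eq_smul_one] using
        a.2.le_algebraMap_of_norm_le (le_refl ‖(a : A)‖))
    have h₂ := hχ (a - (-‖a‖) • 1) (by
      simpa [Algebra.algebraMap_eq_smul_one, neg_le_iff_add_nonneg] using
        a.2.algebraMap_neg_le_of_norm_le (le_refl ‖(a : A)‖))
    rw [map_sub, map_smul, hχ1, smul_zero] at h₁ h₂
    linarith
  rcases hone_nonneg.eq_or_lt with hφ1 | hφ1
  · refine hfh' ?_
    rw [hfφψ, hbound φ hφ hφ1.symm, hbound ψ hψ (hone ▸ hφ1.symm), sub_zero]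
  obtain ⟨Φ, hΦ, hΦφ⟩ := exists_isState_eq_div φ hφ hφ1
  obtain ⟨Ψ, hΨ, hΨψ⟩ := exists_isState_eq_div ψ hψ (hone ▸ hφ1)
  have hΦΨ : Φ = Ψ := hI.2.2.2.2.2 Φ Ψ hΦ hΨ fun a ha => by
    have h₁ := hΦφ ⟨a, hI.2.1 a ha⟩
    have h₂ := hΨψ ⟨a, hI.2.1 a ha⟩
    have h₃ := (hfφψ _).symm.trans (hf_zero _ (hIV ha))
    rw [h₁, h₂, sub_eq_zero.1 h₃, hone]
  have hval : ((φ ⟨h, hh⟩ / φ 1 : ℝ) : ℂ) = ((ψ ⟨h, hh⟩ / ψ 1 : ℝ) : ℂ) := by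
    rw [← hΦφ, ← hΨψ, hΦΨ]
  rw [Complex.ofReal_inj, ← hone, div_left_inj' hφ1.ne'] at hval
  exact hfh' (by rw [hfφψ, hval, sub_self])

end Isocone

/-- Scalar shifts that are far enough apart separate the spectra of bounded self-adjoint
elements. -/
theorem csSup_spectrum_le_csInf_spectrum_algebraMap_add {A : Type*} [CStarAlgebra A] {a b : A}
    (ha : IsSelfAdjoint a) (hb : IsSelfAdjoint b) {r s R : ℝ} (haR : ‖a‖ ≤ R) (hbR : ‖b‖ ≤ R)
    (hrs : r + 2 * R ≤ s) :
    sSup (spectrum ℝ (algebraMap ℝ A r + a)) ≤ sInf (spectrum ℝ (algebraMap ℝ A s + b)) := by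
  let _ := CStarAlgebra.spectralOrder A
  have _ := CStarAlgebra.spectralOrderedRing A
  refine (csSup_spectrum_le_csInf_spectrum_iff ((IsSelfAdjoint.algebraMap A (.all r)).add ha)
    ((IsSelfAdjoint.algebraMap A (.all s)).add hb)).2 ⟨r + R, ?_, ?_⟩
  · rw [map_add]
    exact add_le_add le_rfl (ha.le_algebraMap_of_norm_le haR)
  · calc algebraMap ℝ A (r + R) ≤ algebraMap ℝ A (s + -R) := algebraMap_mono A (by linarith)
      _ = algebraMap ℝ A s + algebraMap ℝ A (-R) := map_add _ _ _
      _ ≤ _ := add_le_add le_rfl (hb.algebraMap_neg_le_of_norm_le hbR)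

theorem ContinuousMap.isSelfAdjoint_apply {X A : Type*} [TopologicalSpace X] [CStarAlgebra A]
    {f : C(X, A)} (hf : IsSelfAdjoint f) (x : X) : IsSelfAdjoint (f x) :=
  congrArg (fun g : C(X, A) => g x) hf.star_eq

/-- Evaluation at a point as a star homomorphism out of `C(X, A)`, for possibly noncommutative
`A`. -/
def ContinuousMap.evalCStarAlgHom {X : Type*} (A : Type*) [TopologicalSpace X] [CStarAlgebra A]
    (x : X) : C(X, A) →⋆ₐ[ℂ] A where
  toFun f := f x
  map_one' := rfl
  map_mul' _ _ := rfl
  map_zero' := rfl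
  map_add' _ _ := rfl
  commutes' _ := rfl
  map_star' _ := rfl

theorem CStarAlgebra.map_cfc_real {A B : Type*} [CStarAlgebra A] [CStarAlgebra B]
    (φ : A →⋆ₐ[ℂ] B) {g : ℝ → ℝ} (hg : Continuous g) {a : A} (ha : IsSelfAdjoint a) :
    φ (cfc g a) = cfc g (φ a) :=
  StarAlgHom.map_cfc φ g a hg.continuousOn (map_continuous φ) ha (ha.map φ)

/-- Differences of continuous selections of a lower hemicontinuous family of isocones are dense among
the self-adjoint functions. -/
theorem exists_selections_norm_sub_sub_le {P A : Type*} [TopologicalSpace P] [CompactSpace P]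
    [T2Space P] [CStarAlgebra A] {I : P → Set A} (hI : ∀ x, IsIsocone (I x))
    (hlhc : ∀ V : Set A, IsOpen V → IsOpen {x : P | (I x ∩ V).Nonempty})
    {h : C(P, A)} (hh : ∀ x, IsSelfAdjoint (h x)) {ε : ℝ} (hε : 0 < ε) :
    ∃ s t : C(P, A), (∀ x, s x ∈ I x) ∧ (∀ x, t x ∈ I x) ∧ ‖h - (s - t)‖ ≤ ε := by
  obtain ⟨g, hg⟩ := exists_continuous_forall_mem_convex_of_local
    (t := fun x => (I x ×ˢ I x) ∩ {p : A × A | p.1 - p.2 ∈ Metric.ball (h x) ε})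
    (fun x => ((hI x).convex.prod (hI x).convex).inter
      ((convex_ball (h x) ε).linear_preimage (LinearMap.fst ℝ A A - LinearMap.snd ℝ A A)))
    (fun x => by
      obtain ⟨a, ha, b, hb, hab⟩ := (hI x).exists_norm_sub_sub_lt (hh x) hε
      have hsel {c : A} (hc : c ∈ I x) := exists_continuous_selection_apply_eq
        (fun y => (hI y).1) (fun y => (hI y).convex) (fun y => (hI y).2.2.2.2.1) hlhc hc
      obtain ⟨s, hs, hsx⟩ := hsel ha
      obtain ⟨t, ht, htx⟩ := hsel hb
      have hcont : Continuous fun y => ‖h y - (s y - t y)‖ := by fun_prop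
      refine ⟨{y | ‖h y - (s y - t y)‖ < ε},
        (isOpen_lt hcont continuous_const).mem_nhds (by simpa [hsx, htx] using hab),
        fun y => (s y, t y), by fun_prop, fun y hy => ⟨⟨hs y, ht y⟩, ?_⟩⟩
      exact mem_ball_iff_norm'.2 hy)
  refine ⟨⟨fun x => (g x).1, by fun_prop⟩, ⟨fun x => (g x).2, by fun_prop⟩,
    fun x => (hg x).1.1, fun x => (hg x).1.2, ?_⟩
  exact (ContinuousMap.norm_le _ hε.le).2 fun x => (mem_ball_iff_norm'.1 (hg x).2).le

/-- the lexicographic sum of isocones over a compact metrizable poset with closed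
strict order and lower hemi-continuous isocone map is an isocone of `C(P, A)`. -/
theorem lexicographicSum_isIsocone_continuous
    (P : Type*) [TopologicalSpace P] [CompactSpace P]
    [TopologicalSpace.MetrizableSpace P] [PartialOrder P]
    (hstrict : IsClosed {p : P × P | p.1 < p.2})
    (A : Type*) [CStarAlgebra A]
    (I : P → Set A) (hI : ∀ x, IsIsocone (I x))
    (hlhc : ∀ V : Set A, IsOpen V → IsOpen {x : P | (I x ∩ V).Nonempty}) :
    IsIsocone {f : C(P, A) |
      (∀ x : P, f x ∈ I x) ∧
      ∀ x y : P, x < y →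
        sSup (spectrum ℝ (f x)) ≤ sInf (spectrum ℝ (f y))} := by
  let _ := CStarAlgebra.spectralOrder A
  have _ := CStarAlgebra.spectralOrderedRing A
  have hsa {x : P} {a : A} (ha : a ∈ I x) : IsSelfAdjoint a := (hI x).2.1 a ha
  have hsa' {f : C(P, A)} (hf : ∀ x, f x ∈ I x) : IsSelfAdjoint f :=
    ContinuousMap.ext fun x => (hsa (hf x)).star_eq
  obtain ⟨u, hu⟩ := exists_continuous_add_one_le_of_lt hstrict
  have hshift (s : C(P, A)) (hs : ∀ x, s x ∈ I x) (R : ℝ) (hR : ‖s‖ ≤ R) :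
      (⟨fun x => algebraMap ℝ A (2 * R * u x) + s x, by fun_prop⟩ : C(P, A)) ∈
        {f : C(P, A) | (∀ x : P, f x ∈ I x) ∧
          ∀ x y : P, x < y → sSup (spectrum ℝ (f x)) ≤ sInf (spectrum ℝ (f y))} := by
    refine ⟨fun x => (hI x).2.2.2.1 _ ((hI x).algebraMap_mem _) _ (hs x), fun x y hxy => ?_⟩
    refine csSup_spectrum_le_csInf_spectrum_algebraMap_add (hsa (hs x)) (hsa (hs y))
      ((s.norm_coe_le_norm x).trans hR) ((s.norm_coe_le_norm y).trans hR) ?_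
    have := mul_le_mul_of_nonneg_left (hu x y hxy)
      (mul_nonneg zero_le_two ((norm_nonneg s).trans hR))
    linarith
  have hzero (x : P) : (0 : C(P, A)) x ∈ I x := by simpa using (hI x).algebraMap_mem 0
  refine ⟨⟨_, hshift 0 hzero 0 (by simp)⟩, fun f hf => hsa' hf.1, ?_, ?_, ?_, ?_⟩
  · rintro f ⟨hf, hlex⟩ g hg hmono
    have hcfc (x : P) := CStarAlgebra.map_cfc_real (ContinuousMap.evalCStarAlgHom A x) hg (hsa' hf)
    refine ⟨fun x => ?_, fun x y hxy => ?_⟩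
    · exact (congrArg (· ∈ I x) (hcfc x)).mpr ((hI x).2.2.1 _ (hf x) g hg hmono)
    · refine (congrArg₂ (fun a b => sSup (spectrum ℝ a) ≤ sInf (spectrum ℝ b))
        (hcfc x) (hcfc y)).mpr ?_
      exact csSup_spectrum_le_csInf_spectrum_cfc (hsa (hf x)) (hsa (hf y)) hg hmono (hlex x y hxy)
  · rintro f ⟨hf, hflex⟩ g ⟨hg, hglex⟩
    exact ⟨fun x => (hI x).2.2.2.1 _ (hf x) _ (hg x), fun x y hxy =>
      csSup_spectrum_le_csInf_spectrum_add (hsa (hf x)) (hsa (hf y)) (hsa (hg x)) (hsa (hg y))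
        (hflex x y hxy) (hglex x y hxy)⟩
  · refine isClosed_of_closure_subset fun f hf => ?_
    have hmem (x : P) : f x ∈ I x := by
      rw [← (hI x).2.2.2.2.1.closure_eq]
      exact map_mem_closure (f := fun g : C(P, A) => g x) (continuous_eval_const x) hf
        fun g hg => hg.1 x
    refine ⟨hmem, fun x y hxy => csSup_spectrum_le_csInf_spectrum_of_forall_norm_sub_le
      (hsa (hmem x)) (hsa (hmem y)) fun ε hε => ?_⟩
    obtain ⟨g, ⟨hg, hglex⟩, hfg⟩ := Metric.mem_closure_iff.1 hf ε hε
    rw [dist_eq_norm] at hfg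
    exact ⟨g x, g y, hsa (hg x), hsa (hg y), ((f - g).norm_coe_le_norm x).trans hfg.le,
      ((f - g).norm_coe_le_norm y).trans hfg.le, hglex x y hxy⟩
  · intro φ ψ hφ hψ hagree
    have hsel (s : C(P, A)) (hs : ∀ x, s x ∈ I x) : φ s = ψ s := by
      have h₁ := hagree _ (hshift s hs ‖s‖ le_rfl)
      have h₂ := hagree _ (hshift 0 hzero ‖s‖ (by simp))
      have hsplit : (⟨fun x => algebraMap ℝ A (2 * ‖s‖ * u x) + s x, by fun_prop⟩ : C(P, A)) =
          (⟨fun x => algebraMap ℝ A (2 * ‖s‖ * u x) + (0 : C(P, A)) x, by fun_prop⟩ : C(P, A))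
            + s := by
        ext x
        simp
      rw [hsplit, map_add, map_add, h₂] at h₁
      exact add_left_cancel h₁
    have hself (h : C(P, A)) (hh : IsSelfAdjoint h) : φ h = ψ h := by
      rw [← sub_eq_zero, ← norm_le_zero_iff]
      refine le_of_forall_pos_le_add fun ε hε => ?_
      obtain ⟨s, t, hs, ht, hst⟩ := exists_selections_norm_sub_sub_le hI hlhc
        (ContinuousMap.isSelfAdjoint_apply hh) (half_pos hε)
      have hd : IsSelfAdjoint (h - (s - t)) := hh.sub ((hsa' hs).sub (hsa' ht))
      have heq : φ h - ψ h = φ (h - (s - t)) - ψ (h - (s - t)) := by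
        simp only [map_sub, hsel s hs, hsel t ht]
        ring
      rw [heq]
      linarith [norm_sub_le (φ (h - (s - t))) (ψ (h - (s - t))), hφ.norm_apply_le hd,
        hψ.norm_apply_le hd]
    ext f
    rw [← realPart_add_I_smul_imaginaryPart f, map_add, map_add, map_smul, map_smul,
      hself _ (realPart f).2, hself _ (imaginaryPart f).2]
end

section
/- Let A be a unital C*-algebra and let I ⊆ Re(A) be a nonempty subset which is stable under sums, stable under continuous non-decreasing functional calculus (so in particular I contains all real multiples of the unit), and norm-closed. Then I separates the states of A (any two states agreeing on I are equal) if and only if the norm closure of the set of differences I − I = {a − b : a, b ∈ I} equals Re(A). -/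
open scoped ComplexOrder

open scoped ComplexStarModule

section StateLemmas

variable {A : Type*} [CStarAlgebra A]

/-- The complex-linear extension to `A` of a real-linear functional on the self-adjoint part. -/
noncomputable def complexExtension (g : selfAdjoint A →ₗ[ℝ] ℝ) : A →ₗ[ℂ] ℂ :=
  Module.Dual.extendRCLike (𝕜 := ℂ) (g ∘ₗ realPart)

lemma complexExtension_coe (g : selfAdjoint A →ₗ[ℝ] ℝ) (a : selfAdjoint A) :
    complexExtension g (a : A) = (g a : ℂ) := by
  have h : ℜ (Complex.I • (a : A)) = 0 := by
    rw [realPart_I_smul, a.2.imaginaryPart, neg_zero]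
  simp [complexExtension, Module.Dual.extendRCLike_apply, h, selfAdjoint.realPart_coe]

lemma isState_complexExtension {g : selfAdjoint A →ₗ[ℝ] ℝ} (h1 : g 1 = 1)
    (hg : ∀ b : A, 0 ≤ g ⟨star b * b, .star_mul_self b⟩) : IsState (complexExtension g) := by
  refine ⟨by simpa [h1] using complexExtension_coe g 1, fun b => ?_⟩
  have := complexExtension_coe g ⟨star b * b, .star_mul_self b⟩
  rw [this]
  exact_mod_cast hg b

lemma IsState.continuous {φ : A →ₗ[ℂ] ℂ} (hφ : IsState φ) : Continuous φ := by
  let _ := CStarAlgebra.spectralOrder A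
  let _ := CStarAlgebra.spectralOrderedRing A
  let Φ : A →ₚ[ℂ] ℂ := PositiveLinearMap.mk₀ φ fun x hx => by
    obtain ⟨b, rfl⟩ := CStarAlgebra.nonneg_iff_eq_star_mul_self.1 hx
    exact hφ.2 b
  exact map_continuous Φ

lemma LinearMap.ext_selfAdjoint {φ ψ : A →ₗ[ℂ] ℂ} (h : ∀ a : A, IsSelfAdjoint a → φ a = ψ a) :
    φ = ψ := by
  ext a
  rw [← realPart_add_I_smul_imaginaryPart a]
  simp only [map_add, map_smul, h _ (ℜ a).2, h _ (ℑ a).2]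

section Order

variable [PartialOrder A] [StarOrderedRing A]

/-- A positive functional on the self-adjoint part which vanishes at `1` is zero. -/
lemma eq_zero_of_nonneg_of_map_one_eq_zero {g : selfAdjoint A →ₗ[ℝ] ℝ}
    (hg : ∀ a : selfAdjoint A, 0 ≤ (a : A) → 0 ≤ g a) (h1 : g 1 = 0) : g = 0 := by
  have key (a : selfAdjoint A) : g a ≤ 0 := by
    have := hg (‖(a : A)‖ • 1 - a) (by
      simpa [Algebra.algebraMap_eq_smul_one] using a.2.le_algebraMap_norm_self)
    simpa [h1] using this
  ext a
  have := key (-a)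
  rw [map_neg] at this
  exact le_antisymm (key a) (neg_nonpos.1 this)

/-- Every bounded real functional is dominated by a positive functional on the
self-adjoint part. -/
lemma exists_nonneg_ge (f : A →L[ℝ] ℝ) : ∃ g : selfAdjoint A →ₗ[ℝ] ℝ,
    ∀ a : selfAdjoint A, 0 ≤ (a : A) → 0 ≤ g a ∧ f a ≤ g a := by
  let s : PointedCone ℝ (selfAdjoint A × ℝ) :=
    { carrier := {p | ∃ (y : A) (r : ℝ), 0 ≤ y ∧ 0 ≤ r ∧ y ≤ (p.1 : A) + r • 1 ∧
        r * ‖f‖ - f y ≤ p.2}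
      zero_mem' := ⟨0, 0, by simp⟩
      add_mem' := by
        rintro p q ⟨y, r, hy, hr, hyr, hp⟩ ⟨y', r', hy', hr', hyr', hq⟩
        refine ⟨y + y', r + r', add_nonneg hy hy', add_nonneg hr hr', ?_, ?_⟩
        · convert add_le_add hyr hyr' using 1
          simp only [Prod.fst_add, AddSubgroup.coe_add, add_smul]
          abel
        · simp only [map_add, Prod.snd_add]
          linarith
      smul_mem' := by
        rintro ⟨c, hc⟩ p ⟨y, r, hy, hr, hyr, hp⟩
        refine ⟨c • y, c * r, smul_nonneg hc hy, mul_nonneg hc hr, ?_, ?_⟩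
        · convert smul_le_smul_of_nonneg_left hyr hc using 1
          simp [smul_add, mul_smul]
        · have := mul_le_mul_of_nonneg_left hp hc
          simp only [map_smul, smul_eq_mul]
          change _ ≤ c * p.2
          linarith }
  let F : (selfAdjoint A × ℝ) →ₗ.[ℝ] ℝ :=
    ⟨LinearMap.ker (LinearMap.fst ℝ (selfAdjoint A) ℝ),
      LinearMap.snd ℝ (selfAdjoint A) ℝ ∘ₗ Submodule.subtype _⟩
  have hnonneg (x : F.domain) (hx : (x : selfAdjoint A × ℝ) ∈ s) : 0 ≤ F x := by
    obtain ⟨⟨z, t⟩, hz⟩ := x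
    obtain ⟨y, r, hy, hr, hyr, ht⟩ := hx
    obtain rfl : z = 0 := by simpa [F] using hz
    change 0 ≤ t
    have hyn : ‖y‖ ≤ r := by
      rw [CStarAlgebra.norm_le_iff_le_algebraMap y hr]
      simpa [Algebra.algebraMap_eq_smul_one] using hyr
    have h1 := (le_abs_self _).trans (f.le_opNorm y)
    have h2 := mul_le_mul_of_nonneg_left hyn (norm_nonneg f)
    dsimp only at ht
    linarith
  have hdense (p : selfAdjoint A × ℝ) : ∃ x : F.domain, (x : selfAdjoint A × ℝ) + p ∈ s := by
    obtain ⟨z, t⟩ := p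
    refine ⟨⟨(0, ‖(z : A)‖ * ‖f‖ - t), by simp [F]⟩, 0, ‖(z : A)‖, le_rfl, norm_nonneg _, ?_, ?_⟩
    · have := z.2.neg_algebraMap_norm_le_self
      rw [Algebra.algebraMap_eq_smul_one, neg_le_iff_add_nonneg] at this
      simpa using this
    · simp
  obtain ⟨G, hGF, hGs⟩ := riesz_extension s F hnonneg hdense
  have hG (t : ℝ) : G (0, t) = t := hGF ⟨(0, t), by simp [F]⟩
  refine ⟨G ∘ₗ LinearMap.inl ℝ _ ℝ, fun a ha => ⟨?_, ?_⟩⟩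
  · exact hGs (a, 0) ⟨0, 0, by simpa using ha⟩
  · have h := hGs (a, -f a) ⟨a, 0, by simpa using ha⟩
    have hsplit : ((a, -f a) : selfAdjoint A × ℝ) = (a, 0) + (0, -f a) := by simp
    rw [hsplit, map_add, hG] at h
    simpa using h

end Order

/-- A bounded real functional which vanishes at `1` but not at some self-adjoint element
yields two distinct states that agree on the self-adjoint part of its kernel. -/
lemma exists_states_of_functional (f : A →L[ℝ] ℝ) (h1 : f 1 = 0) {a : A} (ha : IsSelfAdjoint a)
    (hfa : f a ≠ 0) : ∃ φ ψ : A →ₗ[ℂ] ℂ, IsState φ ∧ IsState ψ ∧ φ ≠ ψ ∧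
      ∀ b, IsSelfAdjoint b → f b = 0 → φ b = ψ b := by
  let _ := CStarAlgebra.spectralOrder A
  let _ := CStarAlgebra.spectralOrderedRing A
  obtain ⟨g, hg⟩ := exists_nonneg_ge f
  let f' : selfAdjoint A →ₗ[ℝ] ℝ := f.toLinearMap ∘ₗ (selfAdjoint.submodule ℝ A).subtype
  have hf' (b : selfAdjoint A) : f' b = f b := rfl
  have hh (b : selfAdjoint A) (hb : 0 ≤ (b : A)) : 0 ≤ (g - f') b := by
    simpa [hf'] using (hg b hb).2
  have hh1 : (g - f') 1 = g 1 := by simp [hf', h1]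
  have hpos : 0 < g 1 := by
    refine lt_of_le_of_ne (hg 1 (by simp)).1 fun h0 => hfa ?_
    have e1 := eq_zero_of_nonneg_of_map_one_eq_zero (fun b hb => (hg b hb).1) h0.symm
    have e2 := eq_zero_of_nonneg_of_map_one_eq_zero hh (hh1.trans h0.symm)
    have := LinearMap.congr_fun e2 ⟨a, ha⟩
    simpa [e1, hf'] using this
  have hc : 0 ≤ (g 1)⁻¹ := (inv_pos.2 hpos).le
  refine ⟨complexExtension ((g 1)⁻¹ • g), complexExtension ((g 1)⁻¹ • (g - f')),
    isState_complexExtension ?_ ?_, isState_complexExtension ?_ ?_, fun heq => hfa ?_, ?_⟩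
  · simp [hpos.ne']
  · exact fun b => mul_nonneg hc (hg _ (star_mul_self_nonneg b)).1
  · rw [LinearMap.smul_apply, hh1, smul_eq_mul, inv_mul_cancel₀ hpos.ne']
  · exact fun b => mul_nonneg hc (hh _ (star_mul_self_nonneg b))
  · have := LinearMap.congr_fun heq ((⟨a, ha⟩ : selfAdjoint A) : A)
    rw [complexExtension_coe, complexExtension_coe, Complex.ofReal_inj] at this
    have := mul_left_cancel₀ (inv_ne_zero hpos.ne') this
    rw [LinearMap.sub_apply, hf'] at this
    linarith
  · intro b hb hfb
    have e1 := complexExtension_coe ((g 1)⁻¹ • g) ⟨b, hb⟩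
    have e2 := complexExtension_coe ((g 1)⁻¹ • (g - f')) ⟨b, hb⟩
    rw [e1, e2]
    simp [hf', hfb]

/-- A closed real subspace of self-adjoint elements that contains `1` and separates the states
contains every self-adjoint element. -/
lemma mem_of_separates_states (V : Submodule ℝ A) (hV : IsClosed (V : Set A))
    (hVsa : ∀ a ∈ V, IsSelfAdjoint a) (h1 : (1 : A) ∈ V)
    (hsep : ∀ φ ψ : A →ₗ[ℂ] ℂ, IsState φ → IsState ψ → (∀ a ∈ V, φ a = ψ a) → φ = ψ)
    {a : A} (ha : IsSelfAdjoint a) : a ∈ V := by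
  by_contra haV
  obtain ⟨f, u, hfu, hua⟩ := geometric_hahn_banach_closed_point V.convex hV haV
  have hf (v : A) (hv : v ∈ V) : f v = 0 := by
    by_contra hne
    have := hfu _ (V.smul_mem (u / f v) hv)
    rw [map_smul, smul_eq_mul, div_mul_cancel₀ _ hne] at this
    exact lt_irrefl _ this
  have hu : 0 < u := by simpa using hfu 0 V.zero_mem
  obtain ⟨φ, ψ, hφ, hψ, hne, hagree⟩ :=
    exists_states_of_functional f (hf 1 h1) ha (hu.trans hua).ne'
  exact hne (hsep φ ψ hφ hψ fun v hv => hagree v (hVsa v hv) (hf v hv))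

end StateLemmas

/-- for a nonempty, sum-stable, non-decreasing-functional-calculus-stable and
norm-closed set `I` of self-adjoint elements, separating the states is equivalent to the
density of `I − I` in the self-adjoint part. -/
theorem separates_states_iff_differences_dense {A : Type*} [CStarAlgebra A]
    (I : Set A)
    (hne : I.Nonempty)
    (hsa : ∀ a ∈ I, IsSelfAdjoint a)
    (hadd : ∀ a ∈ I, ∀ b ∈ I, a + b ∈ I)
    (hcfc : ∀ a ∈ I, ∀ f : ℝ → ℝ, Continuous f → Monotone f → cfc f a ∈ I)
    (hclosed : IsClosed I) :
    (∀ φ ψ : A →ₗ[ℂ] ℂ, IsState φ → IsState ψ → (∀ a ∈ I, φ a = ψ a) → φ = ψ) ↔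
      closure {c : A | ∃ a ∈ I, ∃ b ∈ I, c = a - b} = {a : A | IsSelfAdjoint a} := by
  obtain ⟨a₀, ha₀⟩ := hne
  have hconst (r : ℝ) : r • (1 : A) ∈ I := by
    have := hcfc a₀ ha₀ (fun _ => r) continuous_const monotone_const
    rwa [cfc_const r a₀ (hsa a₀ ha₀), Algebra.algebraMap_eq_smul_one] at this
  have hsmul (r : ℝ) (hr : 0 ≤ r) (a : A) (ha : a ∈ I) : r • a ∈ I := by
    have := hcfc a ha (fun x => r * x) (by fun_prop) fun x y hxy =>
      mul_le_mul_of_nonneg_left hxy hr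
    rwa [cfc_const_mul_id r a (hsa a ha)] at this
  have hzero : (0 : A) ∈ I := by simpa using hconst 0
  let W : Submodule ℝ A :=
    { carrier := {c : A | ∃ a ∈ I, ∃ b ∈ I, c = a - b}
      zero_mem' := ⟨0, hzero, 0, hzero, by simp⟩
      add_mem' := by
        rintro _ _ ⟨a, ha, b, hb, rfl⟩ ⟨c, hc, d, hd, rfl⟩
        exact ⟨a + c, hadd a ha c hc, b + d, hadd b hb d hd, by abel⟩
      smul_mem' := by
        rintro r _ ⟨a, ha, b, hb, rfl⟩
        rcases le_total 0 r with hr | hr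
        · exact ⟨r • a, hsmul r hr a ha, r • b, hsmul r hr b hb, smul_sub r a b⟩
        · have hr' := neg_nonneg.2 hr
          exact ⟨(-r) • b, hsmul _ hr' b hb, (-r) • a, hsmul _ hr' a ha, by module⟩ }
  have hIW (a : A) (ha : a ∈ I) : a ∈ W := ⟨a, ha, 0, hzero, (sub_zero a).symm⟩
  have hWsa : closure (W : Set A) ⊆ {a : A | IsSelfAdjoint a} := by
    refine closure_minimal ?_ (isClosed_eq continuous_star continuous_id)
    rintro _ ⟨a, ha, b, hb, rfl⟩
    exact (hsa a ha).sub (hsa b hb)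
  change _ ↔ closure (W : Set A) = _
  constructor
  · intro hsep
    refine hWsa.antisymm fun a ha => ?_
    refine mem_of_separates_states W.topologicalClosure W.isClosed_topologicalClosure
      (fun b hb => hWsa hb) (W.le_topologicalClosure (hIW 1 (by simpa using hconst 1))) ?_ ha
    exact fun φ ψ hφ hψ h => hsep φ ψ hφ hψ fun b hb => h b (W.le_topologicalClosure (hIW b hb))
  · intro hW φ ψ hφ hψ h
    refine LinearMap.ext_selfAdjoint fun a ha => ?_
    have ha' : a ∈ closure (W : Set A) := hW ▸ ha
    refine closure_minimal ?_ (isClosed_eq hφ.continuous hψ.continuous) ha'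
    rintro _ ⟨b, hb, c, hc, rfl⟩
    simp [h b hb, h c hc]
end

section
/- The real linear span of the set of continuous functions f : [−π, π]² → ℝ that are non-decreasing with respect to the product order (i.e. μ ≤ μ′ and ν ≤ ν′ imply f(μ, ν) ≤ f(μ′, ν′)) is dense in the Banach space C([−π, π]², ℝ) of continuous real-valued functions with the supremum norm. -/
/-- The submonoid of nonnegative monotone functions in `C(X, ℝ)`. -/
def nonnegMonotoneSubmonoid (X : Type*) [TopologicalSpace X] [Preorder X] :
    Submonoid C(X, ℝ) where
  carrier := {f | Monotone f ∧ ∀ x, 0 ≤ f x}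
  one_mem' := ⟨fun _ _ _ => le_rfl, fun _ => zero_le_one⟩
  mul_mem' := fun hf hg =>
    ⟨hf.1.mul hg.1 hf.2 hg.2, fun x => mul_nonneg (hf.2 x) (hg.2 x)⟩

/-- If the continuous monotone real functions on a compact preordered space separate points,
then their linear span is dense. -/
theorem dense_span_monotone_of_separatesPoints {X : Type*} [TopologicalSpace X] [CompactSpace X]
    [Preorder X]
    (hsep : ∀ x y : X, x ≠ y → ∃ f : C(X, ℝ), Monotone f ∧ f x ≠ f y) :
    Dense (Submodule.span ℝ {f : C(X, ℝ) | Monotone f} : Set C(X, ℝ)) := by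
  set A : Subalgebra ℝ C(X, ℝ) := Algebra.adjoin ℝ (nonnegMonotoneSubmonoid X) with hA
  have hA_sep : A.SeparatesPoints := by
    intro x y hxy
    obtain ⟨f, hf, hne⟩ := hsep x y hxy
    refine ⟨_, ⟨f + ContinuousMap.const X ‖f‖, Algebra.subset_adjoin ⟨?_, fun z => ?_⟩, rfl⟩, ?_⟩
    · exact hf.add_const ‖f‖
    · have := (abs_le.mp (f.norm_coe_le_norm z)).1
      simp only [ContinuousMap.add_apply, ContinuousMap.const_apply]
      linarith
    · simpa using hne
  have hA_dense : Dense (A : Set C(X, ℝ)) := fun f =>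
    ContinuousMap.continuousMap_mem_subalgebra_closure_of_separatesPoints A hA_sep f
  refine hA_dense.mono fun f hf => ?_
  have hf_span : f ∈ Subalgebra.toSubmodule A := hf
  rw [hA, Algebra.adjoin_eq_span, Submonoid.closure_eq] at hf_span
  exact Submodule.span_mono (fun g hg => hg.1) hf_span

/-- the real linear span of the continuous functions on `[−π, π]²` that are
non-decreasing for the product order is dense in `C([−π, π]², ℝ)` with the supremum norm. -/
theorem span_monotone_dense_in_continuous_functions :
    Dense (↑(Submodule.span ℝ
        {f : C(Set.Icc (-Real.pi) Real.pi × Set.Icc (-Real.pi) Real.pi, ℝ) |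
          Monotone ⇑f}) :
      Set C(Set.Icc (-Real.pi) Real.pi × Set.Icc (-Real.pi) Real.pi, ℝ)) := by
  refine dense_span_monotone_of_separatesPoints fun x y hxy => ?_
  by_cases h : x.1 = y.1
  · exact ⟨⟨fun z => (z.2 : ℝ), by fun_prop⟩, fun _ _ hab => hab.2,
      fun he => hxy (Prod.ext h (Subtype.ext he))⟩
  · exact ⟨⟨fun z => (z.1 : ℝ), by fun_prop⟩, fun _ _ hab => hab.1,
      fun he => h (Subtype.ext he)⟩
end
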